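/- Let γ₀,…,γ_k and δ₀,…,δ_k be families of elements with γ_i, δ_i ∈ P_{n_i} and γ_i ≤_B δ_i in the weak Bruhat order of P_{n_i} for each 0 ≤ i ≤ k. Then γ₀×…×γ_k ≤_B δ₀×…×δ_k in the weak Bruhat order of P_{n₀+…+n_k}. -/

import Mathlib

namespace PaperP

/-- `IsPF n r f` : `f` represents a surjective map `{1,…,n} → {1,…,r}` (an element of
`P_{n,r}`), normalized so that `f v = 0` for `v ∉ {1,…,n}`. -/
def IsPF (n r : ℕ) (f : ℕ → ℕ) : Prop :=
  (∀ v : ℕ, f v ≠ 0 ↔ (1 ≤ v ∧ v ≤ n)) ∧ f '' Set.Icc 1 n = Set.Icc 1 r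

/-- The product `γ × δ ∈ P_{n+m,r+s}` of `γ ∈ P_{n,r}` and `δ ∈ P_{m,s}`:
`(γ×δ)(i) = γ(i)` for `1 ≤ i ≤ n` and `(γ×δ)(n+i) = δ(i)+r` for `1 ≤ i ≤ m`. -/
def prodF (n r : ℕ) (f g : ℕ → ℕ) : ℕ → ℕ := fun v =>
  if v ≤ n then f v else if g (v - n) = 0 then 0 else g (v - n) + r

/-- The identity map `1_r` of `{1,…,r}`. -/
def idF (r : ℕ) : ℕ → ℕ := fun v => if 1 ≤ v ∧ v ≤ r then v else 0

/-- The map `t_i ∈ P_{r,r-1}` : `t_i(j) = j` for `j ≤ i` and `t_i(j) = j-1` for `j > i`. -/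
def tF (r i : ℕ) : ℕ → ℕ := fun v =>
  if 1 ≤ v ∧ v ≤ r then (if v ≤ i then v else v - 1) else 0

/-- The block-increasing condition: `γ` is increasing on each of the consecutive blocks of
sizes `ns = (n₁,…,n_r)` (positions are 1-based). -/
def BlockIncr (ns : List ℕ) (f : ℕ → ℕ) : Prop :=
  ∀ j < ns.length, ∀ a b : ℕ, (ns.take j).sum < a → a < b → b ≤ (ns.take (j + 1)).sum →
    f a < f b

/-- Membership in the set of shuffles `SH(n₁,…,n_r) ⊆ P_n`, `n = n₁+…+n_r`. -/
def InSH (ns : List ℕ) (f : ℕ → ℕ) : Prop :=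
  (∃ r : ℕ, IsPF ns.sum r f) ∧ BlockIncr ns f

/-- `γ⁻¹(i) < γ⁻¹(i+1)` : every element of `γ⁻¹(i)` is smaller than every element of
`γ⁻¹(i+1)`. -/
def InvIncr (f : ℕ → ℕ) (i : ℕ) : Prop := ∀ a b : ℕ, f a = i → f b = i + 1 → a < b

/-- `γ⁻¹(i) > γ⁻¹(i+1)` : every element of `γ⁻¹(i)` is larger than every element of
`γ⁻¹(i+1)`. -/
def InvDecr (f : ℕ → ℕ) (i : ℕ) : Prop := ∀ a b : ℕ, f a = i → f b = i + 1 → b < a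

/-- One covering step of the weak Bruhat order on `P_n` :
`γ <_B t_i ∘ γ` when `γ⁻¹(i) < γ⁻¹(i+1)`, and `t_i ∘ γ <_B γ` when `γ⁻¹(i) > γ⁻¹(i+1)`,
for `γ ∈ P_{n,r}` and `1 ≤ i ≤ r-1`. -/
def BStep (n : ℕ) (f g : ℕ → ℕ) : Prop :=
  ∃ r i : ℕ, 1 ≤ i ∧ i + 1 ≤ r ∧
    ((IsPF n r f ∧ InvIncr f i ∧ g = tF r i ∘ f) ∨
     (IsPF n r g ∧ InvDecr g i ∧ f = tF r i ∘ g))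

/-- The weak Bruhat order `≤_B` on `P_n`, the reflexive-transitive closure of `BStep`. -/
def BLE (n : ℕ) : (ℕ → ℕ) → (ℕ → ℕ) → Prop := Relation.ReflTransGen (BStep n)

/-- Turn a (1-based) list of values into a normalized map `ℕ → ℕ`. -/
def ofList (l : List ℕ) : ℕ → ℕ := fun v => if v = 0 then 0 else l.getD (v - 1) 0

/-- The maximal shuffle `ξ_{n₁,…,n_r}` :
`ξ(k) = k - (n₁+…+n_{j-1}) + (n_{j+1}+…+n_r)` for `n₁+…+n_{j-1} < k ≤ n₁+…+n_j`. -/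
def xiF : List ℕ → ℕ → ℕ
  | [], _ => 0
  | m :: rest, k =>
      if k = 0 then 0 else if k ≤ m then k + rest.sum else xiF rest (k - m)

/-- The list `z(n₀,…,n_k) = (1,…,n₀, n+1, n₀+1,…,n₀+n₁, n+1, …, n+1, n₀+…+n_{k-1}+1,…,n)`
where `n = n₀+…+n_k` (built with an accumulator `start`). -/
def zList (n : ℕ) : ℕ → List ℕ → List ℕ
  | _, [] => []
  | start, [m] => List.range' (start + 1) m
  | start, m :: rest => List.range' (start + 1) m ++ (n + 1) :: zList n (start + m) rest

/-- `z(n₀,…,n_k)` as a normalized map. -/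
def zF (ns : List ℕ) : ℕ → ℕ := ofList (zList ns.sum 0 ns)

/-- The iterated product `γ₀ × … × γ_k` of a family, each member given as a triple
`(nᵢ, rᵢ, γᵢ)` with `γᵢ ∈ P_{nᵢ,rᵢ}`; returns `(Σnᵢ, Σrᵢ, γ₀×…×γ_k)`. -/
def prodFam : List (ℕ × ℕ × (ℕ → ℕ)) → ℕ × ℕ × (ℕ → ℕ)
  | [] => (0, 0, fun _ => 0)
  | (n, r, f) :: rest =>
      let p := prodFam rest
      (n + p.1, r + p.2.1, prodF n r f p.2.2)

/-- The wedge `⋁_ω(γ₀,…,γ_k) = ((ω ∘ (γ₀×…×γ_k)) × 1₁) ∘ z(n₀,…,n_k)` of a family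
`γᵢ ∈ P_{nᵢ,rᵢ}` over a shuffle `ω ∈ SH(r₀,…,r_k)`. -/
def wedgeF (ω : ℕ → ℕ) (fam : List (ℕ × ℕ × (ℕ → ℕ))) : ℕ → ℕ :=
  prodF (prodFam fam).1 (prodFam fam).2.1 (ω ∘ (prodFam fam).2.2) (idF 1) ∘
    zF (fam.map (·.1))

theorem isPF_iff {n r : ℕ} {f : ℕ → ℕ} :
    IsPF n r f ↔ (∀ v, f v ≠ 0 ↔ (1 ≤ v ∧ v ≤ n)) ∧ (∀ v, f v ≤ r) ∧
      ∀ w, 1 ≤ w → w ≤ r → ∃ v, f v = w := by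
  unfold IsPF
  refine and_congr_right fun h0 => ⟨fun h => ⟨fun v => ?_, fun w h1 h2 => ?_⟩, ?_⟩
  · by_cases hv : f v = 0
    · omega
    · have : f v ∈ Set.Icc 1 r := h ▸ Set.mem_image_of_mem f ((h0 v).1 hv)
      exact this.2
  · have : w ∈ f '' Set.Icc 1 n := h ▸ ⟨h1, h2⟩
    obtain ⟨v, -, hv⟩ := this
    exact ⟨v, hv⟩
  · rintro ⟨hle, hsurj⟩
    ext w
    constructor
    · rintro ⟨v, hv, rfl⟩
      exact ⟨Nat.one_le_iff_ne_zero.2 ((h0 v).2 hv), hle v⟩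
    · rintro ⟨h1, h2⟩
      obtain ⟨v, rfl⟩ := hsurj w h1 h2
      exact ⟨v, (h0 v).1 (by omega), rfl⟩

theorem IsPF.rank_unique {n r s : ℕ} {f : ℕ → ℕ} (h : IsPF n r f) (h' : IsPF n s f) :
    r = s := by
  have := congrArg Set.ncard (h.2.symm.trans h'.2)
  simpa [← Finset.coe_Icc] using this

theorem IsPF.tF_comp {n r i : ℕ} {f : ℕ → ℕ} (h : IsPF n r f) (hi : 1 ≤ i) (hir : i + 1 ≤ r) :
    IsPF n (r - 1) (tF r i ∘ f) := by
  rw [isPF_iff] at h ⊢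
  obtain ⟨h0, hle, hsurj⟩ := h
  refine ⟨fun v => ?_, fun v => ?_, fun w h1 h2 => ?_⟩
  · rw [← h0 v]
    have := hle v
    simp only [tF, Function.comp]
    split_ifs <;> omega
  · have := hle v
    simp only [tF, Function.comp]
    split_ifs <;> omega
  · by_cases hw : w ≤ i
    · obtain ⟨v, hv⟩ := hsurj w h1 (by omega)
      refine ⟨v, ?_⟩
      simp only [tF, Function.comp, hv]
      split_ifs <;> omega
    · obtain ⟨v, hv⟩ := hsurj (w + 1) (by omega) (by omega)
      refine ⟨v, ?_⟩
      simp only [tF, Function.comp, hv]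
      split_ifs <;> omega

theorem IsPF.prodF {n m r s : ℕ} {f g : ℕ → ℕ} (hf : IsPF n r f) (hg : IsPF m s g) :
    IsPF (n + m) (r + s) (prodF n r f g) := by
  rw [isPF_iff] at hf hg ⊢
  obtain ⟨f0, fle, fsurj⟩ := hf
  obtain ⟨g0, gle, gsurj⟩ := hg
  refine ⟨fun v => ?_, fun v => ?_, fun w h1 h2 => ?_⟩
  · have := f0 v
    have := g0 (v - n)
    simp only [PaperP.prodF]
    split_ifs <;> omega
  · have := fle v
    have := gle (v - n)
    simp only [PaperP.prodF]
    split_ifs <;> omega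
  · by_cases hw : w ≤ r
    · obtain ⟨v, hv⟩ := fsurj w h1 hw
      have := f0 v
      refine ⟨v, ?_⟩
      simp only [PaperP.prodF]
      split_ifs <;> omega
    · obtain ⟨v, hv⟩ := gsurj (w - r) (by omega) (by omega)
      have := g0 v
      refine ⟨n + v, ?_⟩
      simp only [PaperP.prodF, Nat.add_sub_cancel_left]
      split_ifs <;> omega

theorem prodF_tF_left {n m r s i : ℕ} {f g : ℕ → ℕ} (hf : IsPF n r f) (hg : IsPF m s g)
    (hir : i + 1 ≤ r) :
    prodF n (r - 1) (tF r i ∘ f) g = tF (r + s) i ∘ prodF n r f g := by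
  rw [isPF_iff] at hf hg
  funext v
  have := hf.2.1 v
  have := hg.2.1 (v - n)
  simp only [prodF, tF, Function.comp]
  split_ifs <;> omega

theorem prodF_tF_right {n m r s i : ℕ} {f g : ℕ → ℕ} (hf : IsPF n r f) (hg : IsPF m s g)
    (hi : 1 ≤ i) :
    prodF n r f (tF s i ∘ g) = tF (r + s) (r + i) ∘ prodF n r f g := by
  rw [isPF_iff] at hf hg
  funext v
  have := hf.2.1 v
  have := hg.2.1 (v - n)
  simp only [prodF, tF, Function.comp]
  split_ifs <;> omega

theorem prodF_eq_left {n r w v : ℕ} {f g : ℕ → ℕ} (hw : 1 ≤ w) (hwr : w ≤ r)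
    (h : prodF n r f g v = w) : f v = w := by
  simp only [prodF] at h
  split_ifs at h <;> omega

theorem prodF_eq_right {n r w v : ℕ} {f g : ℕ → ℕ} (hf : IsPF n r f) (hw : 1 ≤ w)
    (h : prodF n r f g v = r + w) : n < v ∧ g (v - n) = w := by
  have := (isPF_iff.1 hf).2.1 v
  simp only [prodF] at h
  split_ifs at h <;> omega

theorem BStep.isPF {n : ℕ} {f g : ℕ → ℕ} (h : BStep n f g) :
    (∃ r, IsPF n r f) ∧ ∃ s, IsPF n s g := by
  obtain ⟨r, i, hi, hir, ⟨hf, -, rfl⟩ | ⟨hg, -, rfl⟩⟩ := h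
  · exact ⟨⟨r, hf⟩, r - 1, hf.tF_comp hi hir⟩
  · exact ⟨⟨r - 1, hg.tF_comp hi hir⟩, r, hg⟩

theorem BStep.prodF_left {n m r r' s : ℕ} {f f' g : ℕ → ℕ} (h : BStep n f f')
    (hf : IsPF n r f) (hf' : IsPF n r' f') (hg : IsPF m s g) :
    BStep (n + m) (prodF n r f g) (prodF n r' f' g) := by
  obtain ⟨q, i, hi, hiq, ⟨hq, hinv, rfl⟩ | ⟨hq, hinv, rfl⟩⟩ := h
  · obtain rfl := hf.rank_unique hq
    obtain rfl := hf'.rank_unique (hq.tF_comp hi hiq)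
    exact ⟨r + s, i, hi, by omega, .inl ⟨hf.prodF hg, fun a b ha hb =>
      hinv a b (prodF_eq_left hi (by omega) ha) (prodF_eq_left (by omega) hiq hb),
      prodF_tF_left hf hg hiq⟩⟩
  · obtain rfl := hf'.rank_unique hq
    obtain rfl := hf.rank_unique (hq.tF_comp hi hiq)
    exact ⟨r' + s, i, hi, by omega, .inr ⟨hf'.prodF hg, fun a b ha hb =>
      hinv a b (prodF_eq_left hi (by omega) ha) (prodF_eq_left (by omega) hiq hb),
      prodF_tF_left hf' hg hiq⟩⟩

theorem BStep.prodF_right {n m r : ℕ} {f g g' : ℕ → ℕ} (h : BStep m g g')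
    (hf : IsPF n r f) : BStep (n + m) (prodF n r f g) (prodF n r f g') := by
  obtain ⟨q, i, hi, hiq, ⟨hq, hinv, rfl⟩ | ⟨hq, hinv, rfl⟩⟩ := h
  · refine ⟨r + q, r + i, by omega, by omega, .inl ⟨hf.prodF hq, fun a b ha hb => ?_,
      prodF_tF_right hf hq hi⟩⟩
    have ha' := prodF_eq_right hf hi ha
    have hb' := prodF_eq_right hf (Nat.le_add_left 1 i) hb
    have := hinv _ _ ha'.2 hb'.2
    omega
  · refine ⟨r + q, r + i, by omega, by omega, .inr ⟨hf.prodF hq, fun a b ha hb => ?_,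
      prodF_tF_right hf hq hi⟩⟩
    have ha' := prodF_eq_right hf hi ha
    have hb' := prodF_eq_right hf (Nat.le_add_left 1 i) hb
    have := hinv _ _ ha'.2 hb'.2
    omega

theorem BLE.prodF_left {n m r r' s : ℕ} {f f' g : ℕ → ℕ} (h : BLE n f f')
    (hf : IsPF n r f) (hf' : IsPF n r' f') (hg : IsPF m s g) :
    BLE (n + m) (prodF n r f g) (prodF n r' f' g) := by
  induction h using Relation.ReflTransGen.head_induction_on generalizing r with
  | refl =>
    obtain rfl := hf.rank_unique hf'
    exact .refl
  | head hstep _ ih =>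
    obtain ⟨q, hq⟩ := hstep.isPF.2
    exact .head (hstep.prodF_left hf hq hg) (ih hq)

theorem BLE.prodF_right {n m r : ℕ} {f g g' : ℕ → ℕ} (h : BLE m g g') (hf : IsPF n r f) :
    BLE (n + m) (prodF n r f g) (prodF n r f g') := by
  induction h with
  | refl => exact .refl
  | tail _ hstep ih => exact .tail ih (hstep.prodF_right hf)

theorem isPF_prodFam (L : List (ℕ × ℕ × (ℕ → ℕ))) (h : ∀ x ∈ L, IsPF x.1 x.2.1 x.2.2) :
    IsPF (L.map (·.1)).sum (prodFam L).2.1 (prodFam L).2.2 := by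
  induction L with
  | nil =>
    rw [isPF_iff]
    refine ⟨fun v => ?_, fun v => ?_, fun w h1 h2 => ?_⟩
    · simp [prodFam]
      omega
    · simp [prodFam]
    · simp only [prodFam] at h2
      omega
  | cons x L ih =>
    rw [List.forall_mem_cons] at h
    exact h.1.prodF (ih h.2)

/-- if `γᵢ ≤_B δᵢ` in `P_{nᵢ}` for `0 ≤ i ≤ k`, then
`γ₀×…×γ_k ≤_B δ₀×…×δ_k` in `P_{n₀+…+n_k}`.  The families are encoded as lists
`L, L'` of triples `(nᵢ, rᵢ, γᵢ)`, resp. `(nᵢ, sᵢ, δᵢ)`, related pairwise. -/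
theorem prod_mono_weak_order (L L' : List (ℕ × ℕ × (ℕ → ℕ))) (hne : L ≠ [])
    (h : List.Forall₂ (fun x y =>
      x.1 = y.1 ∧ IsPF x.1 x.2.1 x.2.2 ∧ IsPF y.1 y.2.1 y.2.2 ∧
      BLE x.1 x.2.2 y.2.2) L L') :
    BLE ((L.map (·.1)).sum) (prodFam L).2.2 (prodFam L').2.2 := by
  clear hne
  suffices (∀ x ∈ L, IsPF x.1 x.2.1 x.2.2) ∧
      BLE ((L.map (·.1)).sum) (prodFam L).2.2 (prodFam L').2.2 from this.2
  induction h with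
  | nil => exact ⟨by simp, .refl⟩
  | @cons x y L L' hxy _ ih =>
    obtain ⟨n, r, f⟩ := x
    obtain ⟨n', r', f'⟩ := y
    obtain ⟨rfl, hf, hf', hle⟩ := hxy
    obtain ⟨hL, ihle⟩ := ih
    exact ⟨List.forall_mem_cons.2 ⟨hf, hL⟩,
      (hle.prodF_left hf hf' (isPF_prodFam L hL)).trans (ihle.prodF_right hf')⟩

end PaperP
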